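/- For every 1 ≤ i ≤ n−1, one has g_i² = 1 + (q − q^{−1})·e_i·g_i in H_{n,r}. -/

import Mathlib

open Polynomial

namespace MAK

noncomputable section

variable (R : Type*) [CommRing R] (n r : ℕ) (q Δ : Rˣ) (u : Fin r → R) (F : Fin r → R[X])

/-- The free `R`-algebra on generators `t_1, …, t_n` (left) and `T_1, …, T_{n-1}` (right). -/
abbrev FA := FreeAlgebra R (Fin n ⊕ Fin (n - 1))

/-- The generators `t_i`. -/
def tf (i : Fin n) : FA R n := FreeAlgebra.ι R (Sum.inl i)

/-- The generators `T_j`. -/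
def Tf (j : Fin (n - 1)) : FA R n := FreeAlgebra.ι R (Sum.inr j)

/-- The index `j`, viewed in `Fin n`. -/
def lo (j : Fin (n - 1)) : Fin n := ⟨j.1, by have := j.2; omega⟩

/-- The index `j + 1`, viewed in `Fin n`. -/
def hi (j : Fin (n - 1)) : Fin n := ⟨j.1 + 1, by have := j.2; omega⟩

/-- The element `B_j = Δ⁻² Σ_{c1<c2} (u_{c2} - u_{c1})(q - q⁻¹) F_{c1}(t_j) F_{c2}(t_{j+1})`. -/
def Bel (j : Fin (n - 1)) : FA R n :=
  ∑ c2 : Fin r, ∑ c1 ∈ Finset.univ.filter (fun c1 => c1 < c2),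
    (((Δ⁻¹ : Rˣ) : R) ^ 2 * ((u c2 - u c1) * ((q : R) - ((q⁻¹ : Rˣ) : R)))) •
      (aeval (tf R n (lo n j)) (F c1) * aeval (tf R n (hi n j)) (F c2))

/-- The defining relations of the modified Ariki-Koike algebra. -/
inductive Rel : FA R n → FA R n → Prop
  | quad (j : Fin (n - 1)) :
      Rel ((Tf R n j - algebraMap R (FA R n) (q : R)) *
        (Tf R n j + algebraMap R (FA R n) ((q⁻¹ : Rˣ) : R))) 0
  | tord (i : Fin n) : Rel (aeval (tf R n i) (∏ c : Fin r, (X - C (u c)))) 0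
  | braid (j k : Fin (n - 1)) (h : k.1 = j.1 + 1) :
      Rel (Tf R n j * Tf R n k * Tf R n j) (Tf R n k * Tf R n j * Tf R n k)
  | Tcomm (j k : Fin (n - 1)) (h : j.1 + 2 ≤ k.1 ∨ k.1 + 2 ≤ j.1) :
      Rel (Tf R n j * Tf R n k) (Tf R n k * Tf R n j)
  | tcomm (i i' : Fin n) : Rel (tf R n i * tf R n i') (tf R n i' * tf R n i)
  | Tt (j : Fin (n - 1)) (i : Fin n) (h1 : i ≠ lo n j) (h2 : i ≠ hi n j) :
      Rel (Tf R n j * tf R n i) (tf R n i * Tf R n j)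
  | Thi (j : Fin (n - 1)) :
      Rel (Tf R n j * tf R n (hi n j)) (tf R n (lo n j) * Tf R n j + Bel R n r q Δ u F j)
  | Tlo (j : Fin (n - 1)) :
      Rel (Tf R n j * tf R n (lo n j)) (tf R n (hi n j) * Tf R n j - Bel R n r q Δ u F j)

/-- The modified Ariki-Koike algebra `H_{n,r}(R, q, u_1, …, u_r)`. -/
abbrev Hnr := RingQuot (Rel R n r q Δ u F)

/-- The canonical projection. -/
def pim : FA R n →ₐ[R] Hnr R n r q Δ u F := RingQuot.mkAlgHom R (Rel R n r q Δ u F)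

/-- The generator `t_i` of `H_{n,r}`. -/
def tt (i : Fin n) : Hnr R n r q Δ u F := pim R n r q Δ u F (tf R n i)

/-- The generator `T_j` of `H_{n,r}`. -/
def TT (j : Fin (n - 1)) : Hnr R n r q Δ u F := pim R n r q Δ u F (Tf R n j)

/-- The Lagrange basis polynomial `∏_{j ≠ c} (X - u_j)/(u_c - u_j)`. -/
def bpoly (c : Fin r) : R[X] :=
  ∏ j ∈ Finset.univ.filter (fun j => j ≠ c), Ring.inverse (u c - u j) • (X - C (u j))

/-- The idempotent `b_{k_1, …, k_n}`. -/
def b (k : Fin n → Fin r) : Hnr R n r q Δ u F :=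
  (List.ofFn fun i : Fin n => aeval (tt R n r q Δ u F i) (bpoly R r u (k i))).prod

/-- The element `B'_{i,j} = -(q - q⁻¹) Σ_{k_i < k_j} b_{k_1, …, k_n}`. -/
def B' (i j : Fin n) : Hnr R n r q Δ u F :=
  -(((q : R) - ((q⁻¹ : Rˣ) : R)) •
    ∑ k ∈ Finset.univ.filter (fun k : Fin n → Fin r => k i < k j), b R n r q Δ u F k)

/-- The element `g_i := T_i + B'_{i,i+1}`. -/
def g (j : Fin (n - 1)) : Hnr R n r q Δ u F :=
  TT R n r q Δ u F j + B' R n r q Δ u F (lo n j) (hi n j)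

/-- The idempotent `e_{i,j} = Σ_{k_i = k_j} b_{k_1, …, k_n}`. -/
def eij (i j : Fin n) : Hnr R n r q Δ u F :=
  ∑ k ∈ Finset.univ.filter (fun k : Fin n → Fin r => k i = k j), b R n r q Δ u F k

/-- The idempotent `e_i = e_{i,i+1}`. -/
def ee (j : Fin (n - 1)) : Hnr R n r q Δ u F := eij R n r q Δ u F (lo n j) (hi n j)

/-- The simple transposition `s_j = (j, j+1)` in `S_n`. -/
def simple (j : Fin (n - 1)) : Equiv.Perm (Fin n) := Equiv.swap (lo n j) (hi n j)

/-- `l` is a reduced word for the permutation `w`. -/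
def IsReducedWord (w : Equiv.Perm (Fin n)) (l : List (Fin (n - 1))) : Prop :=
  (l.map (simple n)).prod = w ∧
    ∀ l' : List (Fin (n - 1)), (l'.map (simple n)).prod = w → l.length ≤ l'.length

/-- The element `g_w = g_{i_1} ⋯ g_{i_l}` associated to a word `l = (i_1, …, i_l)`. -/
def gword (l : List (Fin (n - 1))) : Hnr R n r q Δ u F := (l.map (g R n r q Δ u F)).prod

/-- The element `T_w = T_{i_1} ⋯ T_{i_l}` associated to a word `l = (i_1, …, i_l)`. -/
def Tword (l : List (Fin (n - 1))) : Hnr R n r q Δ u F := (l.map (TT R n r q Δ u F)).prod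

/-- The monomial `t_1^{c_1} ⋯ t_n^{c_n}`. -/
def tmon (c : Fin n → ℕ) : Hnr R n r q Δ u F :=
  (List.ofFn fun i : Fin n => tt R n r q Δ u F i ^ c i).prod

end

end MAK

namespace MAK

section SumsOfProducts

open Finset

theorem sum_prod_filter_eq {A κ : Type*} [CommRing A] [Fintype κ] [DecidableEq κ] {n : ℕ}
    (a : Fin n → κ → A) (ha : ∀ l, ∑ c, a l c = 1) {i j : Fin n} (hij : i ≠ j)
    (p : κ → κ → Prop) [DecidableRel p] :
    ∑ k ∈ univ.filter (fun k : Fin n → κ => p (k i) (k j)), ∏ l, a l (k l) =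
      ∑ c ∈ univ.filter (fun c : κ × κ => p c.1 c.2), a i c.1 * a j c.2 := by
  rw [← sum_fiberwise_of_maps_to (t := univ.filter (fun c : κ × κ => p c.1 c.2))
    (g := fun k : Fin n → κ => (k i, k j)) (by simp)]
  refine sum_congr rfl fun c hc => ?_
  have hc' : p c.1 c.2 := by simpa using hc
  have key := prod_univ_sum
    (fun l : Fin n => if l = i then {c.1} else if l = j then {c.2} else univ) a
  rw [prod_eq_mul i j hij
    (fun l _ hl => by rw [if_neg hl.1, if_neg hl.2, ha l]) (by simp) (by simp)] at key
  simp only [if_true, if_neg hij.symm, sum_singleton] at key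
  rw [key]
  refine sum_congr ?_ fun _ _ => rfl
  ext k
  simp only [mem_filter, mem_univ, true_and, Fintype.mem_piFinset]
  constructor
  · rintro ⟨-, rfl⟩ l
    split_ifs with h1 h2
    · simp [h1]
    · simp [h2]
    · simp
  · intro h
    have hi := h i
    have hj := h j
    simp only [if_true, if_neg hij.symm, mem_singleton] at hi hj
    rw [hi, hj]
    exact ⟨hc', rfl⟩

open scoped IsMulCommutative in
theorem sum_list_prod_filter_eq {R A κ : Type*} [CommRing R] [Ring A] [Algebra R A] [Fintype κ]
    [DecidableEq κ] {n : ℕ} (a : Fin n → κ → A)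
    (hcomm : ∀ l c l' c', a l c * a l' c' = a l' c' * a l c)
    (ha : ∀ l, ∑ c, a l c = 1) {i j : Fin n} (hij : i ≠ j)
    (p : κ → κ → Prop) [DecidableRel p] :
    ∑ k ∈ univ.filter (fun k : Fin n → κ => p (k i) (k j)),
        (List.ofFn fun l => a l (k l)).prod =
      ∑ c ∈ univ.filter (fun c : κ × κ => p c.1 c.2), a i c.1 * a j c.2 := by
  obtain ⟨S, hS, haS⟩ : ∃ S : Subalgebra R A, IsMulCommutative S ∧ ∀ l c, a l c ∈ S := by
    refine ⟨Algebra.adjoin R (Set.range fun x : Fin n × κ => a x.1 x.2),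
      Algebra.isMulCommutative_adjoin R ?_, fun l c => Algebra.subset_adjoin ⟨(l, c), rfl⟩⟩
    rintro _ ⟨x, rfl⟩ _ ⟨y, rfl⟩
    exact hcomm _ _ _ _
  let a' : Fin n → κ → S := fun l c => ⟨a l c, haS l c⟩
  have h := congrArg S.val (sum_prod_filter_eq a'
    (fun l => Subtype.ext (by simpa [a'] using ha l)) hij p)
  simp only [← List.prod_ofFn, map_sum, map_mul, map_list_prod, List.map_ofFn] at h
  exact h

end SumsOfProducts

section QuadraticRelation

variable {R A : Type*} [CommRing R] [Ring A] [Algebra R A]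

theorem mul_self_eq_of_sub_mul_add_eq_zero {T : A} {a a' : R} (haa' : a * a' = 1)
    (h : (T - algebraMap R A a) * (T + algebraMap R A a') = 0) :
    T * T = 1 + (a - a') • T := by
  rw [sub_mul, mul_add, mul_add, ← map_mul, haa', map_one, ← Algebra.commutes,
    ← Algebra.smul_def, ← Algebra.smul_def] at h
  rw [sub_smul, ← sub_eq_zero, ← h]
  abel

theorem semiconjBy_aeval {g x y : A} (h : SemiconjBy g x y) (f : R[X]) :
    SemiconjBy g (aeval x f) (aeval y f) := by
  induction f using Polynomial.induction_on' with
  | add f f' hf hf' => simpa using hf.add_right hf'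
  | monomial m a =>
    rw [aeval_monomial, aeval_monomial]
    exact SemiconjBy.mul_right (Algebra.commutes a g).symm (h.pow_right m)

theorem aeval_mul_of_mul_eq_smul {x z : A} {a : R} (h : x * z = a • z) (f : R[X]) :
    aeval x f * z = f.eval a • z := by
  induction f using Polynomial.induction_on' with
  | add f f' hf hf' => rw [map_add, add_mul, hf, hf', eval_add, add_smul]
  | monomial m c =>
    have hpow : x ^ m * z = a ^ m • z := by
      induction m with
      | zero => simp
      | succ m ih => rw [pow_succ, mul_assoc, h, mul_smul_comm, ih, smul_smul, ← pow_succ']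
    rw [aeval_monomial, eval_monomial, mul_assoc, hpow, ← Algebra.smul_def, smul_smul]

theorem sq_eq_of_intertwining {κ : Type*} [Fintype κ] [LinearOrder κ] {T x y : A} {h : R}
    {u : κ → R} {β : κ → R[X]} (hT : T * T = 1 + h • T) (hxy : Commute x y)
    (hx : ∀ c, x * aeval x (β c) = u c • aeval x (β c))
    (hy : ∀ c, y * aeval y (β c) = u c • aeval y (β c))
    (hβ : ∑ c, β c = 1) (hβu : ∀ c d, (β c).eval (u d) = if d = c then 1 else 0)
    (hTy : T * y = x * T + ∑ c ∈ Finset.univ.filter (fun c : κ × κ => c.1 < c.2),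
      (h * (u c.2 - u c.1)) • (aeval x (β c.1) * aeval y (β c.2)))
    (hTx : T * x = y * T - ∑ c ∈ Finset.univ.filter (fun c : κ × κ => c.1 < c.2),
      (h * (u c.2 - u c.1)) • (aeval x (β c.1) * aeval y (β c.2))) :
    (T - h • ∑ c ∈ Finset.univ.filter (fun c : κ × κ => c.1 < c.2),
        aeval x (β c.1) * aeval y (β c.2)) ^ 2 =
      1 + h • ((∑ c ∈ Finset.univ.filter (fun c : κ × κ => c.1 = c.2),
        aeval x (β c.1) * aeval y (β c.2)) *
        (T - h • ∑ c ∈ Finset.univ.filter (fun c : κ × κ => c.1 < c.2),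
          aeval x (β c.1) * aeval y (β c.2))) := by
  set P := ∑ c ∈ Finset.univ.filter (fun c : κ × κ => c.1 < c.2),
    aeval x (β c.1) * aeval y (β c.2) with hP
  set E := ∑ c ∈ Finset.univ.filter (fun c : κ × κ => c.1 = c.2),
    aeval x (β c.1) * aeval y (β c.2) with hE
  set N := ∑ c ∈ Finset.univ.filter (fun c : κ × κ => c.2 < c.1),
    aeval x (β c.1) * aeval y (β c.2) with hN
  have hcomm (f f' : R[X]) : Commute (aeval x f) (aeval y f') :=
    semiconjBy_aeval (semiconjBy_aeval hxy.symm f).symm f'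
  have hself (z : A) (f : R[X]) : Commute z (aeval z f) :=
    semiconjBy_aeval (Commute.refl z) f
  have hPx : P * x = ∑ c ∈ Finset.univ.filter (fun c : κ × κ => c.1 < c.2),
      u c.1 • (aeval x (β c.1) * aeval y (β c.2)) := by
    rw [hP, Finset.sum_mul]
    refine Finset.sum_congr rfl fun c _ => ?_
    have h1 : Commute x (aeval y (β c.2)) := semiconjBy_aeval hxy _
    rw [mul_assoc, ← h1.eq, ← mul_assoc, ← (hself x _).eq, hx, smul_mul_assoc]
  have hPy : P * y = ∑ c ∈ Finset.univ.filter (fun c : κ × κ => c.1 < c.2),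
      u c.2 • (aeval x (β c.1) * aeval y (β c.2)) := by
    rw [hP, Finset.sum_mul]
    refine Finset.sum_congr rfl fun c _ => ?_
    rw [mul_assoc, ← (hself y _).eq, hy, mul_smul_comm]
  have hB : ∑ c ∈ Finset.univ.filter (fun c : κ × κ => c.1 < c.2),
      (h * (u c.2 - u c.1)) • (aeval x (β c.1) * aeval y (β c.2)) =
      h • (P * y) - h • (P * x) := by
    rw [hPx, hPy, ← smul_sub, ← Finset.sum_sub_distrib, Finset.smul_sum]
    simp only [mul_smul, sub_smul]
  have hxP : x * P = P * x := by
    rw [hP]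
    exact Commute.sum_right _ _ _ fun c _ => (hself x _).mul_right (semiconjBy_aeval hxy _)
  have hyP : y * P = P * y := by
    rw [hP]
    exact Commute.sum_right _ _ _ fun c _ => Commute.mul_right
      (semiconjBy_aeval hxy.symm _) (hself y _)
  have hPP : P * P = P := by
    have hX (c d : κ) : aeval x (β c) * aeval x (β d) = if d = c then aeval x (β d) else 0 := by
      rw [aeval_mul_of_mul_eq_smul (hx d), hβu, ite_smul, one_smul, zero_smul]
    have hY (c d : κ) : aeval y (β c) * aeval y (β d) = if d = c then aeval y (β d) else 0 := by
      rw [aeval_mul_of_mul_eq_smul (hy d), hβu, ite_smul, one_smul, zero_smul]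
    rw [hP, Finset.sum_mul_sum]
    refine Finset.sum_congr rfl fun c hc => ?_
    rw [Finset.sum_eq_single_of_mem c hc]
    · rw [(hcomm _ _).symm.mul_mul_mul_comm, hX, hY, if_pos rfl, if_pos rfl]
    · intro d _ hdc
      rw [(hcomm _ _).symm.mul_mul_mul_comm, hX, hY]
      by_cases h1 : d.1 = c.1
      · rw [if_neg fun h2 => hdc (Prod.ext h1 h2), mul_zero]
      · rw [if_neg h1, zero_mul]
  rw [hB] at hTx hTy
  have hgy : SemiconjBy (T - h • P) y x := by
    rw [SemiconjBy, sub_mul, mul_sub, hTy, smul_mul_assoc, mul_smul_comm, hxP]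
    abel
  have hgx : SemiconjBy (T - h • P) x y := by
    rw [SemiconjBy, sub_mul, mul_sub, hTx, smul_mul_assoc, mul_smul_comm, hyP]
    abel
  have hgP : (T - h • P) * P = N * (T - h • P) := by
    have : N = ∑ c ∈ Finset.univ.filter (fun c : κ × κ => c.1 < c.2),
        aeval y (β c.1) * aeval x (β c.2) := by
      rw [hN]
      refine Finset.sum_equiv (Equiv.prodComm κ κ) (by simp) fun c _ => ?_
      exact (hcomm _ _).eq
    rw [this]
    simp only [hP, Finset.mul_sum, Finset.sum_mul]
    exact Finset.sum_congr rfl fun c _ =>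
      ((semiconjBy_aeval hgx _).mul_right (semiconjBy_aeval hgy _)).eq
  have hsum : P + E + N = 1 := by
    have hz (z : A) : ∑ c, aeval z (β c) = 1 := by rw [← map_sum, hβ, map_one]
    have h1 : ∑ c : κ × κ, aeval x (β c.1) * aeval y (β c.2) = 1 := by
      simpa only [hz, one_mul, Fintype.sum_prod_type] using
        (Finset.sum_mul_sum Finset.univ Finset.univ (fun c => aeval x (β c))
          fun c => aeval y (β c)).symm
    rw [← h1, hP, hE, hN, Finset.sum_filter, Finset.sum_filter, Finset.sum_filter,
      ← Finset.sum_add_distrib, ← Finset.sum_add_distrib]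
    refine Finset.sum_congr rfl fun c _ => ?_
    rcases lt_trichotomy c.1 c.2 with hc | hc | hc
    · simp [hc, hc.ne, hc.not_gt]
    · simp [hc]
    · simp [hc, hc.ne', hc.not_gt]
  clear_value P E N
  obtain rfl : E = 1 - P - N := by rw [← hsum]; abel
  obtain ⟨G, rfl⟩ : ∃ G, T = G + h • P := ⟨T - h • P, by abel⟩
  rw [add_sub_cancel_right] at hgP ⊢
  have hsq : G ^ 2 = (G + h • P) * (G + h • P) - h • (G * P) - h • (P * G)
      - h • h • (P * P) := by
    simp only [mul_add, add_mul, smul_mul_assoc, mul_smul_comm, sq, smul_add]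
    abel
  rw [hsq, hT, hgP, hPP]
  simp only [sub_mul, one_mul, smul_sub, smul_add]
  abel

end QuadraticRelation

section Lagrange

variable {R : Type*} [CommRing R] {r : ℕ} {Δ : Rˣ} {u : Fin r → R}

theorem isUnit_sub_of_prod_eq
    (hΔ : (Δ : R) = ∏ i : Fin r, ∏ j ∈ Finset.univ.filter (fun j => j < i), (u i - u j))
    {c d : Fin r} (hcd : c ≠ d) : IsUnit (u c - u d) := by
  have key {i j : Fin r} (hji : j < i) : IsUnit (u i - u j) := by
    refine isUnit_of_dvd_unit ?_ Δ.isUnit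
    rw [hΔ]
    exact (Finset.dvd_prod_of_mem (fun j => u i - u j) (by simpa using hji)).trans
      (Finset.dvd_prod_of_mem (fun i => ∏ j ∈ Finset.univ.filter (fun j => j < i), (u i - u j))
        (Finset.mem_univ i))
  rcases hcd.lt_or_gt with h | h
  · rw [← neg_sub]
    exact (key h).neg
  · exact key h

theorem eval_bpoly (hu : ∀ c d : Fin r, c ≠ d → IsUnit (u c - u d)) (c d : Fin r) :
    (bpoly R r u c).eval (u d) = if d = c then 1 else 0 := by
  rw [bpoly, eval_prod]
  split_ifs with h
  · subst h
    refine Finset.prod_eq_one fun i hi => ?_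
    rw [eval_smul, eval_sub, eval_X, eval_C, smul_eq_mul]
    exact Ring.inverse_mul_cancel _ (hu _ _ (by simpa using (Finset.mem_filter.1 hi).2.symm))
  · exact Finset.prod_eq_zero (i := d) (by simpa using h) (by simp)

theorem degree_bpoly_lt [Nontrivial R] (c : Fin r) : (bpoly R r u c).degree < (r : WithBot ℕ) := by
  have hr : 0 < r := c.pos
  refine (degree_prod_le _ _).trans_lt ?_
  calc ∑ j ∈ Finset.univ.filter (fun j => j ≠ c),
        (Ring.inverse (u c - u j) • (X - C (u j))).degree
      ≤ ∑ j ∈ Finset.univ.filter (fun j => j ≠ c), (1 : WithBot ℕ) :=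
        Finset.sum_le_sum (f := fun j => (Ring.inverse (u c - u j) • (X - C (u j))).degree) fun j _ => (degree_smul_le _ _).trans (degree_X_sub_C_le _)
    _ = ((r - 1 : ℕ) : WithBot ℕ) := by
        rw [Finset.sum_const, Finset.filter_ne', Finset.card_erase_of_mem (Finset.mem_univ c),
          Finset.card_univ, Fintype.card_fin, nsmul_one]
    _ < (r : WithBot ℕ) := by exact_mod_cast Nat.sub_lt hr one_pos

theorem X_sub_C_mul_bpoly (c : Fin r) :
    ∃ a : R, (X - C (u c)) * bpoly R r u c = a • ∏ d, (X - C (u d)) := by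
  refine ⟨∏ j ∈ Finset.univ.filter (fun j => j ≠ c), Ring.inverse (u c - u j), ?_⟩
  rw [bpoly, Finset.prod_smul, mul_smul_comm, Finset.filter_ne',
    Finset.mul_prod_erase _ (fun d => X - C (u d)) (Finset.mem_univ c)]

variable [IsDomain R]

theorem eq_of_degree_lt_of_eval_eq (hu : ∀ c d : Fin r, c ≠ d → IsUnit (u c - u d)) {f f' : R[X]}
    (hf : f.degree < (r : WithBot ℕ)) (hf' : f'.degree < (r : WithBot ℕ))
    (h : ∀ c, f.eval (u c) = f'.eval (u c)) : f = f' := by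
  have hinj : Function.Injective u := fun c d hcd => by
    by_contra hne
    exact (hu c d hne).ne_zero (sub_eq_zero.2 hcd)
  exact eq_of_degrees_lt_of_eval_index_eq Finset.univ hinj.injOn
    (by simpa using hf) (by simpa using hf') fun c _ => h c

theorem sum_bpoly (hu : ∀ c d : Fin r, c ≠ d → IsUnit (u c - u d)) (hr : 0 < r) :
    ∑ c, bpoly R r u c = 1 := by
  refine eq_of_degree_lt_of_eval_eq hu ?_ ?_ fun d => ?_
  · rw [← mem_degreeLT]
    exact Submodule.sum_mem _ fun c _ => mem_degreeLT.2 (degree_bpoly_lt c)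
  · rw [degree_one]
    exact_mod_cast hr
  · simp [eval_finsetSum, eval_bpoly hu]

theorem eq_smul_bpoly (hu : ∀ c d : Fin r, c ≠ d → IsUnit (u c - u d)) {c : Fin r} {f : R[X]}
    {a : R} (hf : f.degree < (r : WithBot ℕ)) (h : ∀ d, f.eval (u d) = if d = c then a else 0) :
    f = a • bpoly R r u c :=
  eq_of_degree_lt_of_eval_eq hu hf ((degree_smul_le _ _).trans_lt (degree_bpoly_lt c)) fun d => by
    rw [h, eval_smul, eval_bpoly hu, smul_eq_mul, mul_ite, mul_one, mul_zero]

end Lagrange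

section Presentation

variable {R : Type*} [CommRing R] {n r : ℕ} {q Δ : Rˣ} {u : Fin r → R} {F : Fin r → R[X]}

theorem pim_eq_of_rel {a a' : FA R n} (h : Rel R n r q Δ u F a a') :
    pim R n r q Δ u F a = pim R n r q Δ u F a' :=
  RingQuot.mkAlgHom_rel R h

theorem TT_mul_self (j : Fin (n - 1)) :
    TT R n r q Δ u F j * TT R n r q Δ u F j =
      1 + ((q : R) - ((q⁻¹ : Rˣ) : R)) • TT R n r q Δ u F j := by
  have h := pim_eq_of_rel (Rel.quad (q := q) (Δ := Δ) (u := u) (F := F) j)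
  simp only [map_mul, map_sub, map_add, map_zero, AlgHom.commutes] at h
  exact mul_self_eq_of_sub_mul_add_eq_zero (Units.mul_inv q) h

theorem tt_comm (i i' : Fin n) : Commute (tt R n r q Δ u F i) (tt R n r q Δ u F i') := by
  have h := pim_eq_of_rel (Rel.tcomm (q := q) (Δ := Δ) (u := u) (F := F) i i')
  rwa [map_mul, map_mul] at h

theorem tt_mul_aeval_bpoly (i : Fin n) (c : Fin r) :
    tt R n r q Δ u F i * aeval (tt R n r q Δ u F i) (bpoly R r u c) =
      u c • aeval (tt R n r q Δ u F i) (bpoly R r u c) := by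
  have h := pim_eq_of_rel (Rel.tord (q := q) (Δ := Δ) (u := u) (F := F) i)
  rw [← aeval_algHom_apply, map_zero] at h
  change aeval (tt R n r q Δ u F i) _ = 0 at h
  obtain ⟨a, ha⟩ := X_sub_C_mul_bpoly (u := u) c
  have h' := congrArg (aeval (tt R n r q Δ u F i)) ha
  rw [map_smul, h, smul_zero, map_mul, map_sub, aeval_X, aeval_C, sub_mul, sub_eq_zero,
    ← Algebra.smul_def] at h'
  exact h'

theorem pim_Bel (hF : ∀ c, F c = (Δ : R) • bpoly R r u c) (j : Fin (n - 1)) :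
    pim R n r q Δ u F (Bel R n r q Δ u F j) =
      ∑ c ∈ Finset.univ.filter (fun c : Fin r × Fin r => c.1 < c.2),
        (((q : R) - ((q⁻¹ : Rˣ) : R)) * (u c.2 - u c.1)) •
          (aeval (tt R n r q Δ u F (lo n j)) (bpoly R r u c.1) *
            aeval (tt R n r q Δ u F (hi n j)) (bpoly R r u c.2)) := by
  rw [Bel, Finset.sum_filter, Fintype.sum_prod_type_right, map_sum]
  refine Finset.sum_congr rfl fun c2 _ => ?_
  rw [map_sum, Finset.sum_filter]
  refine Finset.sum_congr rfl fun c1 _ => ?_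
  split_ifs
  · rw [map_smul, map_mul, ← aeval_algHom_apply, ← aeval_algHom_apply]
    change _ • (aeval (tt R n r q Δ u F (lo n j)) (F c1) *
      aeval (tt R n r q Δ u F (hi n j)) (F c2)) = _
    have hΔ : ((Δ⁻¹ : Rˣ) : R) * (Δ : R) = 1 := Units.inv_mul Δ
    rw [hF c1, hF c2, map_smul, map_smul, smul_mul_smul_comm, smul_smul]
    congr 1
    linear_combination ((u c2 - u c1) * ((q : R) - ((q⁻¹ : Rˣ) : R))) *
      (((Δ⁻¹ : Rˣ) : R) * (Δ : R) + 1) * hΔ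
  · rfl

end Presentation

end MAK

open MAK


/-- Proposition 3.5: the quadratic relation `g_i² = 1 + (q - q⁻¹) e_i g_i`. -/
theorem statement5
    (R : Type*) [CommRing R] [IsDomain R] (n r : ℕ) (hn : 1 ≤ n) (hr : 1 ≤ r)
    (q Δ : Rˣ) (u : Fin r → R) (F : Fin r → R[X])
    (hΔ : (Δ : R) = ∏ i : Fin r, ∏ j ∈ Finset.univ.filter (fun j => j < i), (u i - u j))
    (hFdeg : ∀ c : Fin r, (F c).degree = ((r - 1 : ℕ) : WithBot ℕ))
    (hFeval : ∀ c c' : Fin r, (F c).eval (u c') = if c' = c then (Δ : R) else 0)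
    (j : Fin (n - 1)) :
    g R n r q Δ u F j ^ 2 = 1 + ((q : R) - ((q⁻¹ : Rˣ) : R)) • (ee R n r q Δ u F j * g R n r q Δ u F j) := by
  have hu : ∀ c d : Fin r, c ≠ d → IsUnit (u c - u d) := fun c d h => isUnit_sub_of_prod_eq hΔ h
  have hF (c : Fin r) : F c = (Δ : R) • bpoly R r u c := by
    refine eq_smul_bpoly hu ?_ (hFeval c)
    rw [hFdeg]
    exact_mod_cast Nat.sub_lt hr one_pos
  have hlohi : lo n j ≠ hi n j := by simp [lo, hi]
  have hsum (p : Fin r → Fin r → Prop) [DecidableRel p] :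
      ∑ k ∈ Finset.univ.filter (fun k : Fin n → Fin r => p (k (lo n j)) (k (hi n j))),
        b R n r q Δ u F k =
      ∑ c ∈ Finset.univ.filter (fun c : Fin r × Fin r => p c.1 c.2),
        aeval (tt R n r q Δ u F (lo n j)) (bpoly R r u c.1) *
          aeval (tt R n r q Δ u F (hi n j)) (bpoly R r u c.2) := by
    refine sum_list_prod_filter_eq (R := R)
      (fun l c => aeval (tt R n r q Δ u F l) (bpoly R r u c)) (fun l c l' c' => ?_)
      (fun l => ?_) hlohi p
    · exact (semiconjBy_aeval (semiconjBy_aeval (tt_comm l' l) _).symm _).eq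
    · rw [← map_sum, sum_bpoly hu hr, map_one]
  rw [g, B', ee, eij, hsum (· < ·), hsum (· = ·), ← sub_eq_add_neg]
  refine sq_eq_of_intertwining (TT_mul_self j) (tt_comm _ _) (tt_mul_aeval_bpoly _)
    (tt_mul_aeval_bpoly _) (sum_bpoly hu hr) (eval_bpoly hu) ?_ ?_
  · rw [← pim_Bel hF]
    have h := pim_eq_of_rel (Rel.Thi (q := q) (Δ := Δ) (u := u) (F := F) j)
    rwa [map_add, map_mul, map_mul] at h
  · rw [← pim_Bel hF]
    have h := pim_eq_of_rel (Rel.Tlo (q := q) (Δ := Δ) (u := u) (F := F) j)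
    rwa [map_sub, map_mul, map_mul] at h
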